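/- arXiv:1305.1685 — 2 statements merged into one kernel-verified Lean document; each statement's English description precedes it below -/
import Mathlib

section
/- There exists an absolute constant ĉ > 0 such that the following holds. Let ψ : ℕ → ℝ satisfy 0 < ψ(k) ≤ 1/2 for all k. Then for every h ≥ 1 and all m, n ∈ Δ_h = {2^{2^h}+1, …, 2^{2^{h+1}}} with m ≠ n, one has λ(E_m ∩ E_n) ≤ ĉ · h · λ(E_m) λ(E_n). -/
open MeasureTheory

/-- The set `E_n ⊆ ℝ/ℤ`. -/
noncomputable def approxSet (ψ : ℕ → ℝ) (n : ℕ) : Set UnitAddCircle :=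
  ⋃ a ∈ {a : ℕ | 1 ≤ a ∧ a ≤ n ∧ Nat.gcd a n = 1},
    (fun x : ℝ => (x : UnitAddCircle)) ''
      Set.Ioo (((a : ℝ) - ψ n) / n) (((a : ℝ) + ψ n) / n)

theorem aux_mertens (n : ℕ) (hn : 1 ≤ n) :
    ∑ p ∈ Nat.primesLE n, Real.log p / p ≤ Real.log n + Real.log 4 := by
  have hn0 : (0:ℝ) < n := by exact_mod_cast hn
  have hmem : ∀ p ∈ Nat.primesLE n, p.Prime ∧ p ≤ n := by
    intro p hp
    rw [Nat.mem_primesLE] at hp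
    exact ⟨hp.2, hp.1⟩
  have hdvd : (∏ p ∈ Nat.primesLE n, p ^ (n / p)) ∣ n.factorial := by
    apply Finset.prod_dvd_of_isRelPrime
    · intro p hp q hq hpq
      have h1 := (hmem p hp).1
      have h2 := (hmem q hq).1
      exact Nat.coprime_iff_isRelPrime.1 (Nat.Coprime.pow _ _ ((Nat.coprime_primes h1 h2).2 hpq))
    · intro p hp
      have h1 : p ^ (n/p) ∣ (p.factorial)^(n/p) :=
        pow_dvd_pow_of_dvd (Nat.dvd_factorial (hmem p hp).1.pos le_rfl) _
      have h2 := Nat.prod_factorial_dvd_factorial_sum (Finset.range (n/p)) (fun _ => p)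
      simp only [Finset.prod_const, Finset.card_range, Finset.sum_const, smul_eq_mul] at h2
      exact (h1.trans h2).trans (Nat.factorial_dvd_factorial (Nat.div_mul_le_self n p))
  have h1 : (∏ p ∈ Nat.primesLE n, p ^ (n / p)) ≤ n ^ n :=
    (Nat.le_of_dvd (Nat.factorial_pos n) hdvd).trans (Nat.factorial_le_pow n)
  have h2 : ∑ p ∈ Nat.primesLE n, ((n / p : ℕ):ℝ) * Real.log p ≤ n * Real.log n := by
    have := Real.log_le_log (x := ((∏ p ∈ Nat.primesLE n, p ^ (n / p) : ℕ):ℝ)) (y := ((n^n : ℕ):ℝ))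
      (by
        norm_cast
        exact Finset.prod_pos fun p hp => pow_pos (hmem p hp).1.pos _) (by exact_mod_cast h1)
    push_cast at this
    rw [Real.log_prod, Real.log_pow] at this
    · simpa [Real.log_pow] using this
    · intro p hp
      have := (hmem p hp).1.pos
      positivity
  have h3 : ∑ p ∈ Nat.primesLE n, Real.log p ≤ Real.log 4 * n := by
    rw [← Chebyshev.theta_eq_sum_primesLE_log]
    exact Chebyshev.theta_le_log4_mul_x hn0.le
  have h4 : n * ∑ p ∈ Nat.primesLE n, Real.log p / p ≤
      ∑ p ∈ Nat.primesLE n, ((n / p : ℕ):ℝ) * Real.log p + ∑ p ∈ Nat.primesLE n, Real.log p := by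
    rw [Finset.mul_sum, ← Finset.sum_add_distrib]
    apply Finset.sum_le_sum
    intro p hp
    have hp0 : (0:ℝ) < p := by exact_mod_cast (hmem p hp).1.pos
    have hl : 0 ≤ Real.log p := Real.log_natCast_nonneg p
    have : (n:ℝ) / p ≤ ((n/p : ℕ):ℝ) + 1 := by
      rw [div_le_iff₀ hp0]
      have := Nat.lt_div_mul_add (a := n) (hmem p hp).1.pos
      have h : n ≤ (n/p + 1) * p := by linarith
      exact_mod_cast h
    calc n * (Real.log p / p) = (n / p) * Real.log p := by ring
      _ ≤ (((n/p : ℕ):ℝ) + 1) * Real.log p := by gcongr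
      _ = _ := by ring
  have h5 : n * ∑ p ∈ Nat.primesLE n, Real.log p / p ≤ n * (Real.log n + Real.log 4) := by linarith
  exact le_of_mul_le_mul_left h5 hn0

theorem aux_recip (J : ℕ) (hJ : 1 ≤ J) :
    ∑ p ∈ Nat.primesLE (2^J), (1:ℝ) / p ≤ Real.log J + 8 := by
  set L := Real.log 2 with hL
  have hLpos : 0 < L := Real.log_pos (by norm_num)
  set S : ℕ → ℝ := fun j => ∑ p ∈ Nat.primesLE (2^j), Real.log p / p with hS
  set T : ℕ → ℝ := fun j => ∑ p ∈ Nat.primesLE (2^j), (1:ℝ) / p with hT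
  have hSb : ∀ j, S j ≤ (j + 2) * L := by
    intro j
    have := aux_mertens (2^j) Nat.one_le_two_pow
    have h4 : Real.log 4 = 2 * L := by
      rw [show (4:ℝ) = 2^2 by norm_num, Real.log_pow, ← hL]; norm_num
    push_cast at this
    rw [Real.log_pow, h4] at this
    simp only [hS]; linarith
  have hstep : ∀ j : ℕ, 1 ≤ j → (T (j+1) - T j) * (j * L) ≤ S (j+1) - S j := by
    intro j hj
    have hsub : Nat.primesLE (2^j) ⊆ Nat.primesLE (2^(j+1)) := by
      intro p
      simp only [Nat.mem_primesLE]
      rintro ⟨h1, h2⟩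
      exact ⟨h1.trans (Nat.pow_le_pow_right (by norm_num) (by omega)), h2⟩
    simp only [hS, hT]
    rw [← Finset.sum_sdiff hsub, ← Finset.sum_sdiff hsub (f := fun p : ℕ => Real.log p / p)]
    rw [add_sub_cancel_right, add_sub_cancel_right, Finset.sum_mul]
    apply Finset.sum_le_sum
    intro p hp
    simp only [Finset.mem_sdiff, Nat.mem_primesLE, not_and] at hp
    have hlt : 2^j < p := by
      by_contra h
      exact hp.2 (by omega) hp.1.2
    have hp0 : (0:ℝ) < p := by exact_mod_cast hp.1.2.pos
    have : j * L ≤ Real.log p := by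
      rw [hL, ← Real.log_pow]
      apply Real.log_le_log (by positivity)
      exact_mod_cast hlt.le
    rw [one_div_mul_eq_div]
    gcongr
  have hU : ∀ j : ℕ, T (j+1) - S (j+1) / ((j+1 : ℕ) * L) ≤ Real.log (j+1:ℕ) + 5 - 3 / (j+1 : ℕ) := by
    intro j
    induction j with
    | zero =>
      have : Nat.primesLE 2 = {2} := by decide
      simp only [hS, hT]
      norm_num [this, ← hL]
      field_simp
      norm_num
    | succ j ih =>
      set k := j + 1 with hk
      have hk0 : (0:ℝ) < k := by positivity
      have h1 := hstep k (by omega)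
      have h2 := hSb (k+1)
      push_cast at h2 ⊢
      have hlog : 1 / ((k:ℝ)+1) ≤ Real.log (k+1) - Real.log k := by
        rw [← Real.log_div (by positivity) (by positivity)]
        have := Real.one_sub_inv_le_log_of_pos (x := ((k:ℝ)+1)/k) (by positivity)
        refine le_trans (le_of_eq ?_) this
        field_simp
        ring
      have h3 : T (k+1) - T k ≤ S (k+1) / (k*L) - S k / (k*L) := by
        rw [← sub_div, le_div_iff₀ (by positivity)]; exact h1
      have h4 : S (k+1) / (k*L) - S (k+1) / ((k+1)*L) = S (k+1) / (k * (k+1) * L) := by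
        field_simp
        ring
      have h5 : S (k+1) / (k * (k+1) * L) ≤ ((k:ℝ)+1+2)/ (k*(k+1)) := by
        rw [div_le_div_iff₀ (by positivity) (by positivity)]
        have : 0 ≤ (k:ℝ)*(k+1) := by positivity
        nlinarith
      have h6 : ((k:ℝ)+1+2)/ (k*(k+1)) = 1/(k+1) + 3/k - 3/(k+1) := by
        field_simp
        ring
      linarith
  obtain ⟨j, rfl⟩ : ∃ j, J = j + 1 := ⟨J - 1, by omega⟩
  have h1 := hU j
  have h2 := hSb (j+1)
  have hj : (0:ℝ) < ((j+1:ℕ):ℝ) := by positivity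
  have h3 : S (j+1) / ((j+1 : ℕ) * L) ≤ 1 + 2 / (j+1:ℕ) := by
    rw [div_le_iff₀ (by positivity)]
    refine h2.trans (le_of_eq ?_)
    field_simp
  have h4 : 2 / ((j+1:ℕ):ℝ) ≤ 3 / ((j+1:ℕ):ℝ) := by gcongr; norm_num
  have : T (j+1) ≤ Real.log (j+1:ℕ) + 8 := by linarith
  exact this

theorem aux_recip_div (N J : ℕ) (hJ : 1 ≤ J) (hN : 1 ≤ N) (hNJ : N ≤ 2^2^J) :
    ∑ p ∈ N.primeFactors, (1:ℝ) / p ≤ Real.log J + 9 := by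
  have hcard : N.primeFactors.card ≤ 2^J := by
    have h1 : 2 ^ N.primeFactors.card ≤ ∏ p ∈ N.primeFactors, p :=
      Finset.pow_card_le_prod _ _ _ (fun p hp => (Nat.prime_of_mem_primeFactors hp).two_le)
    have h2 := Nat.le_of_dvd hN (Nat.prod_primeFactors_dvd N)
    exact (Nat.pow_le_pow_iff_right (by norm_num)).1 (h1.trans (h2.trans hNJ))
  rw [← Finset.sum_filter_add_sum_filter_not _ (fun p => p ≤ 2^J)]
  have h1 : ∑ p ∈ N.primeFactors with p ≤ 2^J, (1:ℝ) / p ≤ Real.log J + 8 := by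
    refine le_trans (Finset.sum_le_sum_of_subset_of_nonneg ?_ ?_) (aux_recip J hJ)
    · intro p hp
      rw [Finset.mem_filter] at hp
      exact Nat.mem_primesLE.2 ⟨hp.2, Nat.prime_of_mem_primeFactors hp.1⟩
    · intros; positivity
  have h2 : ∑ p ∈ N.primeFactors with ¬ p ≤ 2^J, (1:ℝ) / p ≤ 1 := by
    calc _ ≤ ∑ p ∈ N.primeFactors with ¬ p ≤ 2^J, (1:ℝ) / 2^J := by
          apply Finset.sum_le_sum
          intro p hp
          rw [Finset.mem_filter] at hp
          have : (2:ℝ)^J ≤ p := by exact_mod_cast (not_le.1 hp.2).le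
          gcongr
      _ ≤ 1 := by
          rw [Finset.sum_const, nsmul_eq_mul, mul_one_div, div_le_one (by positivity)]
          exact_mod_cast (Finset.card_filter_le _ _).trans hcard
  linarith

noncomputable def auxP (N : ℕ) : ℝ := ∏ p ∈ N.primeFactors, (1 - 1 / (p:ℝ))

theorem auxP_factor {N p : ℕ} (hp : p ∈ N.primeFactors) : 1/2 ≤ 1 - 1 / (p:ℝ) ∧ 1 - 1/(p:ℝ) ≤ 1 := by
  have : (2:ℝ) ≤ p := by exact_mod_cast (Nat.prime_of_mem_primeFactors hp).two_le
  have h1 : 1 / (p:ℝ) ≤ 1/2 := by gcongr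
  have h2 : 0 ≤ 1 / (p:ℝ) := by positivity
  constructor <;> linarith

theorem auxP_pos (N : ℕ) : 0 < auxP N := 
  Finset.prod_pos fun p hp => by linarith [(auxP_factor hp).1]

theorem auxP_totient (N : ℕ) : (N.totient : ℝ) = N * auxP N := by
  have := congrArg (fun q : ℚ => (q:ℝ)) (Nat.totient_eq_mul_prod_factors N)
  push_cast at this
  rw [this, auxP]
  simp

theorem aux_prod_sq (S : Finset ℕ) (hS : ∀ p ∈ S, 2 ≤ p) : (1:ℝ)/2 ≤ ∏ p ∈ S, (1 - 1/(p:ℝ)^2) := by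
  have key : ∀ M : ℕ, ∏ p ∈ Finset.range M, (1 - 1/((p+2 : ℕ):ℝ)^2) = ((M:ℝ)+2)/(2*((M:ℝ)+1)) := by
    intro M
    induction M with
    | zero => norm_num
    | succ M ih =>
      rw [Finset.prod_range_succ, ih]
      push_cast
      field_simp
      ring
  obtain ⟨M, hM⟩ : ∃ M, ∀ p ∈ S, p < M + 2 := ⟨S.sup id, fun p hp => by
    have := Finset.le_sup (f := id) hp
    simp at this; omega⟩
  have hsub : S ⊆ (Finset.range M).image (fun p => p + 2) := by
    intro p hp
    rw [Finset.mem_image]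
    exact ⟨p - 2, by rw [Finset.mem_range]; have := hM p hp; have := hS p hp; omega, by have := hS p hp; omega⟩
  have h1 : ∏ p ∈ (Finset.range M).image (fun p : ℕ => p + 2), (1 - 1/(p:ℝ)^2) = ((M:ℝ)+2)/(2*((M:ℝ)+1)) := by
    rw [Finset.prod_image (by intro a _ b _ h; simpa using h), key]
  have hf : ∀ p : ℕ, 2 ≤ p → 0 ≤ 1 - 1/(p:ℝ)^2 ∧ 1 - 1/(p:ℝ)^2 ≤ 1 := by
    intro p hp
    have h2 : (1:ℝ) ≤ p^2 := by exact_mod_cast Nat.one_le_pow _ _ (by omega)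
    have h3 : 1/(p:ℝ)^2 ≤ 1 := by rw [div_le_one (by linarith)]; exact h2
    have h4 : 0 ≤ 1/(p:ℝ)^2 := by positivity
    constructor <;> linarith
  calc (1:ℝ)/2 ≤ (M+2)/(2*(M+1)) := by
        rw [div_le_div_iff₀ (by norm_num) (by positivity)]; linarith
    _ = _ := h1.symm
    _ ≤ _ := by
      rw [← Finset.prod_sdiff hsub]
      apply mul_le_of_le_one_left
      · exact Finset.prod_nonneg fun p hp => (hf p (hS p hp)).1
      · apply Finset.prod_le_one
        · intro p hp
          simp at hp
          exact (hf p (by omega)).1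
        · intro p hp
          simp at hp
          exact (hf p (by omega)).2

theorem auxP_inv (N : ℕ) : 1 / auxP N ≤ 2 * ∏ p ∈ N.primeFactors, (1 + 1/(p:ℝ)) := by
  rw [div_le_iff₀ (auxP_pos N), auxP, mul_assoc, ← Finset.prod_mul_distrib]
  have := aux_prod_sq N.primeFactors (fun p hp => (Nat.prime_of_mem_primeFactors hp).two_le)
  have h2 : ∏ p ∈ N.primeFactors, ((1 + 1/(p:ℝ)) * (1 - 1/(p:ℝ))) = ∏ p ∈ N.primeFactors, (1 - 1/(p:ℝ)^2) :=
    Finset.prod_congr rfl fun p hp => by ring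
  rw [h2]; linarith

theorem auxP_inv_loglog (N J : ℕ) (hJ : 1 ≤ J) (hN : 1 ≤ N) (hNJ : N ≤ 2^2^J) :
    1 / auxP N ≤ 2 * Real.exp 9 * J := by
  have h := aux_recip_div N J hJ hN hNJ
  have hJ0 : (0:ℝ) < J := by exact_mod_cast hJ
  calc _ ≤ _ := auxP_inv N
    _ ≤ 2 * ∏ p ∈ N.primeFactors, Real.exp (1/(p:ℝ)) := by
      gcongr with p hp
      rw [add_comm]; exact Real.add_one_le_exp _
    _ = 2 * Real.exp (∑ p ∈ N.primeFactors, 1/(p:ℝ)) := by rw [Real.exp_sum]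
    _ ≤ 2 * Real.exp (Real.log J + 9) := by gcongr
    _ = _ := by rw [Real.exp_add, Real.exp_log hJ0]; ring

theorem aux_prod_le_divisors (N : ℕ) (hN : N ≠ 0) :
    ∏ p ∈ N.primeFactors, (1 + 1/(p:ℝ)) ≤ ∑ k ∈ N.divisors, 1/(k:ℝ) := by
  rw [Finset.prod_one_add]
  have hinj : Set.InjOn (fun s : Finset ℕ => ∏ p ∈ s, p) (N.primeFactors.powerset : Set (Finset ℕ)) := by
    intro s hs t ht h
    simp only [Finset.coe_powerset, Set.mem_preimage, Set.mem_powerset_iff, Finset.coe_subset] at hs ht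
    have h1 := Nat.primeFactors_prod (s := s) (fun p hp => Nat.prime_of_mem_primeFactors (hs hp))
    have h2 := Nat.primeFactors_prod (s := t) (fun p hp => Nat.prime_of_mem_primeFactors (ht hp))
    rw [← h1, ← h2]
    exact congrArg _ h
  have : ∑ s ∈ N.primeFactors.powerset, ∏ p ∈ s, 1/(p:ℝ) =
      ∑ k ∈ N.primeFactors.powerset.image (fun s : Finset ℕ => ∏ p ∈ s, p), 1/(k:ℝ) := by
    rw [Finset.sum_image hinj]
    apply Finset.sum_congr rfl
    intro s hs
    push_cast
    rw [Finset.prod_div_distrib]; simp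
  rw [this]
  apply Finset.sum_le_sum_of_subset_of_nonneg
  · intro k hk
    rw [Finset.mem_image] at hk
    obtain ⟨s, hs, rfl⟩ := hk
    rw [Nat.mem_divisors]
    exact ⟨(Finset.prod_dvd_prod_of_subset _ _ _ (Finset.mem_powerset.1 hs)).trans (Nat.prod_primeFactors_dvd N), hN⟩
  · intros; positivity

theorem aux_sum_inv_sq (M : ℕ) : ∑ k ∈ Finset.Icc 1 M, 1/(k:ℝ)^2 ≤ 2 := by
  have : ∀ M : ℕ, ∑ k ∈ Finset.Icc 1 (M+1), 1/(k:ℝ)^2 ≤ 2 - 1/((M+1:ℕ):ℝ) := by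
    intro M
    induction M with
    | zero => norm_num
    | succ M ih =>
      rw [Finset.sum_Icc_succ_top (by omega)]
      have : 1 / ((M+1+1:ℕ):ℝ)^2 ≤ 1/((M+1:ℕ):ℝ) - 1/((M+1+1:ℕ):ℝ) := by
        push_cast
        rw [div_sub_div _ _ (by positivity) (by positivity), div_le_div_iff₀ (by positivity) (by positivity)]
        have : (0:ℝ) ≤ M := by positivity
        nlinarith
      linarith
  rcases M with _ | M
  · norm_num
  · have h := this M
    have : 0 ≤ 1/((M+1:ℕ):ℝ) := by positivity
    linarith

theorem aux_card_mult (M k : ℕ) : (Finset.filter (fun c => k ∣ c) (Finset.Icc 1 M)).card = M / k := by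
  rw [← Nat.card_multiples M k]
  symm
  apply Finset.card_bij (fun a _ => a + 1)
  · intro a ha
    simp only [Finset.mem_filter, Finset.mem_range, Finset.mem_Icc] at ha ⊢
    exact ⟨by omega, ha.2⟩
  · intro a _ b _ h
    omega
  · intro b hb
    simp only [Finset.mem_filter, Finset.mem_Icc] at hb
    have : b - 1 + 1 = b := by omega
    exact ⟨b - 1, by simp only [Finset.mem_filter, Finset.mem_range, this]; exact ⟨by omega, hb.2⟩, this⟩

theorem auxP_sum (M : ℕ) : ∑ c ∈ Finset.Icc 1 M, 1 / auxP c ≤ 4 * M := by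
  calc _ ≤ ∑ c ∈ Finset.Icc 1 M, 2 * ∑ k ∈ c.divisors, 1/(k:ℝ) := by
        apply Finset.sum_le_sum
        intro c hc
        rw [Finset.mem_Icc] at hc
        have h1 := auxP_inv c
        have h2 := aux_prod_le_divisors c (by omega)
        linarith
    _ = 2 * ∑ c ∈ Finset.Icc 1 M, ∑ k ∈ Finset.Icc 1 M, if k ∣ c then 1/(k:ℝ) else 0 := by
        rw [Finset.mul_sum]
        apply Finset.sum_congr rfl
        intro c hc
        rw [Finset.mem_Icc] at hc
        rw [← Finset.sum_filter]
        congr 2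
        ext k
        simp only [Nat.mem_divisors, Finset.mem_filter, Finset.mem_Icc]
        constructor
        · rintro ⟨h1, h2⟩
          exact ⟨⟨Nat.pos_of_dvd_of_pos h1 (by omega), (Nat.le_of_dvd (by omega) h1).trans hc.2⟩, h1⟩
        · rintro ⟨h1, h2⟩
          exact ⟨h2, by omega⟩
    _ = 2 * ∑ k ∈ Finset.Icc 1 M, ((M / k : ℕ):ℝ) * (1/(k:ℝ)) := by
        rw [Finset.sum_comm]
        congr 1
        apply Finset.sum_congr rfl
        intro k hk
        rw [← Finset.sum_filter, Finset.sum_const, nsmul_eq_mul]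
        congr 2
        exact aux_card_mult M k
    _ ≤ 2 * ∑ k ∈ Finset.Icc 1 M, (M:ℝ) * (1/(k:ℝ)^2) := by
        refine mul_le_mul_of_nonneg_left (Finset.sum_le_sum fun k hk => ?_) (by norm_num)
        have : ((M / k : ℕ):ℝ) ≤ M / k := Nat.cast_div_le
        calc ((M / k : ℕ):ℝ) * (1/(k:ℝ)) ≤ (M/k) * (1/(k:ℝ)) := by gcongr
          _ = _ := by ring
    _ ≤ _ := by
        rw [← Finset.mul_sum]
        have := aux_sum_inv_sq M
        have h : (0:ℝ) ≤ M := by positivity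
        nlinarith

theorem aux_sieve (d : ℕ) (hd : 1 ≤ d) (A : ℕ → Finset ℕ) (B : Finset ℕ)
    (hB : ∀ t ∈ B, t < d ∧ ∀ p ∈ d.primeFactors, t % p ∈ A p) :
    (B.card : ℝ) ≤ d * ∏ p ∈ d.primeFactors, ((A p).card / (p:ℝ)) := by
  set r := ∏ p ∈ d.primeFactors, p with hr
  have hrd : r ∣ d := Nat.prod_primeFactors_dvd d
  have hr0 : 0 < r := Nat.pos_of_dvd_of_pos hrd hd
  have h1 : B.card ≤ (Finset.range (d / r) ×ˢ d.primeFactors.pi (fun p => A p)).card := by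
    apply Finset.card_le_card_of_injOn (fun t => (t / r, fun p _ => t % p))
    · intro t ht
      obtain ⟨h1, h2⟩ := hB t ht
      simp only [Finset.coe_product, Set.mem_prod, Finset.mem_coe, Finset.mem_range, Finset.mem_pi]
      refine ⟨Nat.div_lt_div_of_lt_of_dvd hrd h1, h2⟩
    · intro t _ s _ h
      simp only [Prod.mk.injEq] at h
      obtain ⟨h1, h2⟩ := h
      have h3 : ∀ p ∈ d.primeFactors, t ≡ s [MOD p] := fun p hp => congrFun (congrFun h2 p) hp
      have h4 : ((r:ℕ):ℤ) ∣ (s:ℤ) - t := by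
        rw [hr]
        push_cast
        apply Finset.prod_dvd_of_isRelPrime
        · intro p hp q hq hpq
          have h1 := Nat.prime_of_mem_primeFactors hp
          have h2 := Nat.prime_of_mem_primeFactors hq
          have := (Nat.coprime_primes h1 h2).2 hpq
          exact (Nat.isCoprime_iff_coprime.2 this).isRelPrime
        · intro p hp
          exact (Nat.modEq_iff_dvd).1 (h3 p hp)
      have h5 : t % r = s % r := (Nat.modEq_iff_dvd).2 h4
      rw [← Nat.div_add_mod t r, ← Nat.div_add_mod s r, h1, h5]
  rw [Finset.card_product, Finset.card_range, Finset.card_pi] at h1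
  calc (B.card : ℝ) ≤ ((d / r * ∏ p ∈ d.primeFactors, (A p).card : ℕ) : ℝ) := by exact_mod_cast h1
    _ = _ := by
      rw [Finset.prod_div_distrib]
      push_cast [Nat.cast_div hrd (by positivity : (r:ℝ) ≠ 0)]
      rw [hr]; push_cast
      ring

theorem aux_solve (p : ℕ) (hp : p.Prime) (a : ℤ) (u : ℕ) (hu : ¬ p ∣ u) :
    ∃ t ∈ Finset.range p, (p:ℤ) ∣ a + u * t := by
  have := Fact.mk hp
  refine ⟨(-(a : ZMod p) / u).val, Finset.mem_range.2 (ZMod.val_lt _), ?_⟩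
  have hu' : (u : ZMod p) ≠ 0 := by rwa [Ne, ZMod.natCast_eq_zero_iff]
  rw [← ZMod.intCast_zmod_eq_zero_iff_dvd]
  push_cast
  rw [ZMod.natCast_zmod_val]
  field_simp
  ring

open Classical in
theorem aux_resid (p u v : ℕ) (hp : p.Prime) (huv : u.Coprime v) (a b c : ℤ)
    (hc : (p:ℤ) ∣ a * v - b * u - c) :
    ((Finset.filter (fun t : ℕ => ¬ (p:ℤ) ∣ a + u * t ∧ ¬ (p:ℤ) ∣ b + v * t) (Finset.range p)).card / (p:ℝ)) ≤
      (1 - 1/(p:ℝ)) * (if p ∣ u * v * c.natAbs then 1 else (1 - 1/(p:ℝ))) := by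
  set A := Finset.filter (fun t : ℕ => ¬ (p:ℤ) ∣ a + u * t ∧ ¬ (p:ℤ) ∣ b + v * t) (Finset.range p) with hA
  have hp0 : (0:ℝ) < p := by exact_mod_cast hp.pos
  split_ifs with h
  · have : A.card + 1 ≤ p := by
      have hlt : A.card < (Finset.range p).card := by
        apply Finset.card_lt_card
        rw [hA, Finset.filter_ssubset]
        by_cases hu : p ∣ u
        · have hv : ¬ p ∣ v := fun hv => hp.one_lt.ne' (Nat.eq_one_of_dvd_coprimes huv hu hv)
          obtain ⟨t, ht, h⟩ := aux_solve p hp b v hv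
          exact ⟨t, ht, fun h' => h'.2 h⟩
        · obtain ⟨t, ht, h⟩ := aux_solve p hp a u hu
          exact ⟨t, ht, fun h' => h'.1 h⟩
      simpa using hlt
    have : (A.card : ℝ) + 1 ≤ p := by exact_mod_cast this
    rw [div_le_iff₀ hp0]
    field_simp
    linarith
  · have hu : ¬ p ∣ u := fun hu => h (Dvd.dvd.mul_right (Dvd.dvd.mul_right hu _) _)
    have hv : ¬ p ∣ v := fun hu => h (Dvd.dvd.mul_right (Dvd.dvd.mul_left hu _) _)
    have hcc : ¬ (p:ℤ) ∣ c := fun hu => h (Dvd.dvd.mul_left (Int.natCast_dvd.1 hu) _)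
    obtain ⟨t, ht, h1⟩ := aux_solve p hp a u hu
    obtain ⟨s, hs, h2⟩ := aux_solve p hp b v hv
    have hts : t ≠ s := by
      rintro rfl
      apply hcc
      have h3 : (p:ℤ) ∣ (a + u * t) * v - (b + v * t) * u - (a * v - b * u - c) :=
        dvd_sub (dvd_sub (Dvd.dvd.mul_right h1 _) (Dvd.dvd.mul_right h2 _)) hc
      ring_nf at h3
      exact h3
    have : A.card + 2 ≤ p := by
      have h3 : Disjoint A {t, s} := by
        rw [Finset.disjoint_right]
        intro x hx
        simp only [Finset.mem_insert, Finset.mem_singleton] at hx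
        rw [hA, Finset.mem_filter]
        rintro ⟨_, h4, h5⟩
        rcases hx with rfl | rfl
        · exact h4 h1
        · exact h5 h2
      have h4 : (A ∪ {t, s}) ⊆ Finset.range p := by
        apply Finset.union_subset (Finset.filter_subset _ _)
        intro x hx
        simp only [Finset.mem_insert, Finset.mem_singleton] at hx
        rcases hx with rfl | rfl <;> assumption
      have := Finset.card_le_card h4
      rwa [Finset.card_union_of_disjoint h3, Finset.card_pair hts, Finset.card_range] at this
    have : (A.card : ℝ) + 2 ≤ p := by exact_mod_cast this
    have h3 : (A.card : ℝ)/p ≤ 1 - 2/p := by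
      rw [div_le_iff₀ hp0]
      field_simp
      linarith
    have h4 : (1 - 1/(p:ℝ)) * (1 - 1/(p:ℝ)) = 1 - 2/p + (1/(p:ℝ))^2 := by ring
    have : 0 ≤ (1/(p:ℝ))^2 := by positivity
    linarith

open Classical in
noncomputable def auxSols (d u v : ℕ) (c : ℤ) : Finset (ℕ × ℕ) :=
  Finset.filter (fun x => x.1.Coprime (d*u) ∧ x.2.Coprime (d*v) ∧
    ((d*u*v : ℕ):ℤ) ∣ x.1 * v - x.2 * u - c) (Finset.Icc 1 (d*u) ×ˢ Finset.Icc 1 (d*v))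

theorem auxSols_card (d u v : ℕ) (hd : 1 ≤ d) (hu : 1 ≤ u) (hv : 1 ≤ v) (huv : u.Coprime v) (c : ℤ) :
    ((auxSols d u v c).card : ℝ) ≤ d * ∏ p ∈ d.primeFactors,
      ((1 - 1/(p:ℝ)) * (if p ∣ u * v * c.natAbs then 1 else (1 - 1/(p:ℝ)))) := by
  classical
  rcases (auxSols d u v c).eq_empty_or_nonempty with he | ⟨⟨a₀, b₀⟩, h0⟩
  · rw [he, Finset.card_empty, Nat.cast_zero]
    apply mul_nonneg (by positivity)
    apply Finset.prod_nonneg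
    intro p hp
    have := (auxP_factor hp).1
    split_ifs <;> nlinarith
  simp only [auxSols, Finset.mem_filter, Finset.mem_product, Finset.mem_Icc] at h0
  obtain ⟨⟨ha0, hb0⟩, hca, hcb, hdv⟩ := h0
  have hd0 : (0:ℤ) < d := by exact_mod_cast hd
  have hu0 : (0:ℤ) < u := by exact_mod_cast hu
  have hv0 : (0:ℤ) < v := by exact_mod_cast hv
  have key : ∀ x ∈ auxSols d u v c, ∃ τ : ℕ, τ < d ∧ (∃ k : ℤ, (x.1:ℤ) = a₀ + u * τ + k * (d * u)) ∧
      (∃ k : ℤ, (x.2:ℤ) = b₀ + v * τ + k * (d * v)) := by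
    rintro ⟨a, b⟩ hx
    simp only [auxSols, Finset.mem_filter, Finset.mem_product, Finset.mem_Icc] at hx
    obtain ⟨_, _, _, hdv'⟩ := hx
    have h1 : ((d*u*v : ℕ):ℤ) ∣ (a - a₀) * v - (b - b₀) * u := by
      have := dvd_sub hdv' hdv
      have e : ((a:ℤ) - a₀) * v - (b - b₀) * u = ((a:ℤ) * v - b * u - c) - (a₀ * v - b₀ * u - c) := by ring
      rw [e]; exact this
    push_cast at h1
    obtain ⟨q, hq⟩ := h1
    have hcop : IsCoprime (u:ℤ) (v:ℤ) := Nat.isCoprime_iff_coprime.2 huv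
    have h2 : (u:ℤ) ∣ a - a₀ := by
      apply hcop.dvd_of_dvd_mul_right
      exact ⟨(b - b₀) + d * v * q, by linear_combination hq⟩
    have h3 : (v:ℤ) ∣ b - b₀ := by
      apply hcop.symm.dvd_of_dvd_mul_right
      exact ⟨(a - a₀) - d * u * q, by linear_combination -hq⟩
    obtain ⟨t, ht⟩ := h2
    obtain ⟨s, hs⟩ := h3
    have hts : t - s = d * q := by
      have : (u * v : ℤ) * (t - s) = (u * v) * (d * q) := by
        rw [ht, hs] at hq
        linear_combination hq
      exact mul_left_cancel₀ (by positivity) this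
    have hmod := Int.emod_add_mul_ediv t d
    refine ⟨(t % d).toNat, ?_, ⟨t / d, ?_⟩, ⟨t / d - q, ?_⟩⟩
    · have := Int.emod_lt_of_pos t hd0
      have := Int.emod_nonneg t hd0.ne'
      omega
    · rw [Int.toNat_of_nonneg (Int.emod_nonneg t hd0.ne')]
      linear_combination ht - u * hmod
    · rw [Int.toNat_of_nonneg (Int.emod_nonneg t hd0.ne')]
      linear_combination hs - v * hmod - v * hts
  choose! τ hτ1 hτ2 hτ3 using key
  have hinj : Set.InjOn τ (auxSols d u v c : Set (ℕ × ℕ)) := by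
    have aux : ∀ a b M : ℕ, 1 ≤ a → a ≤ M → 1 ≤ b → b ≤ M → ((M:ℕ):ℤ) ∣ (a:ℤ) - b → a = b := by
      intro a b M h1 h2 h3 h4 h5
      have h6 : (a:ℤ) - b = 0 := by
        apply Int.eq_zero_of_abs_lt_dvd h5
        rw [abs_lt]; constructor <;> omega
      omega
    intro x hx y hy hxy
    obtain ⟨k1, hk1⟩ := hτ2 x hx
    obtain ⟨k2, hk2⟩ := hτ2 y hy
    obtain ⟨k3, hk3⟩ := hτ3 x hx
    obtain ⟨k4, hk4⟩ := hτ3 y hy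
    simp only [Finset.mem_coe, auxSols, Finset.mem_filter, Finset.mem_product, Finset.mem_Icc] at hx hy
    rw [hxy] at hk1 hk3
    apply Prod.ext
    · apply aux _ _ (d*u) hx.1.1.1 hx.1.1.2 hy.1.1.1 hy.1.1.2
      exact ⟨k1 - k2, by push_cast; linear_combination hk1 - hk2⟩
    · apply aux _ _ (d*v) hx.1.2.1 hx.1.2.2 hy.1.2.1 hy.1.2.2
      exact ⟨k3 - k4, by push_cast; linear_combination hk3 - hk4⟩
  rw [← Finset.card_image_of_injOn hinj]
  refine (aux_sieve d hd (fun p => Finset.filter (fun t : ℕ => ¬ (p:ℤ) ∣ (a₀:ℤ) + u * t ∧ ¬ (p:ℤ) ∣ (b₀:ℤ) + v * t) (Finset.range p)) _ ?_).trans ?_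
  · intro t ht
    rw [Finset.mem_image] at ht
    obtain ⟨x, hx, rfl⟩ := ht
    refine ⟨hτ1 x hx, ?_⟩
    intro p hp
    have hpp := Nat.prime_of_mem_primeFactors hp
    have hpd := Nat.dvd_of_mem_primeFactors hp
    have hpd' : (p:ℤ) ∣ d := by exact_mod_cast hpd
    obtain ⟨k1, hk1⟩ := hτ2 x hx
    obtain ⟨k3, hk3⟩ := hτ3 x hx
    simp only [auxSols, Finset.mem_filter, Finset.mem_product, Finset.mem_Icc] at hx
    have hmd : (p:ℤ) ∣ (τ x : ℤ) - ((τ x % p : ℕ):ℤ) := by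
      push_cast
      exact Int.dvd_self_sub_emod
    rw [Finset.mem_filter, Finset.mem_range]
    refine ⟨Nat.mod_lt _ hpp.pos, ?_, ?_⟩
    · intro h
      have : (p:ℤ) ∣ (x.1:ℤ) := by
        have h2 : (x.1:ℤ) = (a₀ + u * ((τ x % p : ℕ):ℤ)) + u * ((τ x : ℤ) - ((τ x % p : ℕ):ℤ)) + d * (k1 * u) := by
          linear_combination hk1
        rw [h2]
        exact dvd_add (dvd_add h (Dvd.dvd.mul_left hmd _)) (Dvd.dvd.mul_right hpd' _)
      exact hpp.one_lt.ne' (Nat.eq_one_of_dvd_coprimes hx.2.1 (by exact_mod_cast this) (Dvd.dvd.mul_right hpd _))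
    · intro h
      have : (p:ℤ) ∣ (x.2:ℤ) := by
        have h2 : (x.2:ℤ) = (b₀ + v * ((τ x % p : ℕ):ℤ)) + v * ((τ x : ℤ) - ((τ x % p : ℕ):ℤ)) + d * (k3 * v) := by
          linear_combination hk3
        rw [h2]
        exact dvd_add (dvd_add h (Dvd.dvd.mul_left hmd _)) (Dvd.dvd.mul_right hpd' _)
      exact hpp.one_lt.ne' (Nat.eq_one_of_dvd_coprimes hx.2.2.1 (by exact_mod_cast this) (Dvd.dvd.mul_right hpd _))
  · refine mul_le_mul_of_nonneg_left (Finset.prod_le_prod ?_ ?_) (by positivity)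
    · intros; positivity
    · intro p hp
      have hpp := Nat.prime_of_mem_primeFactors hp
      have hpd := Nat.dvd_of_mem_primeFactors hp
      have h1 : (p:ℤ) ∣ ((d*u*v : ℕ):ℤ) := by
        exact_mod_cast Dvd.dvd.mul_right (Dvd.dvd.mul_right hpd _) _
      convert aux_resid p u v hpp huv a₀ b₀ c (h1.trans hdv)

theorem aux_prod_mono (s t : Finset ℕ) (h : s ⊆ t) (ht : ∀ p ∈ t, 0 ≤ 1 - 1/(p:ℝ)) :
    ∏ p ∈ t, (1 - 1/(p:ℝ)) ≤ ∏ p ∈ s, (1 - 1/(p:ℝ)) := by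
  rw [← Finset.prod_sdiff h]
  apply mul_le_of_le_one_left
  · exact Finset.prod_nonneg fun p hp => ht p (h hp)
  · apply Finset.prod_le_one
    · intro p hp
      exact ht p (Finset.sdiff_subset hp)
    · intro p hp
      have : 0 ≤ 1/(p:ℝ) := by positivity
      linarith

theorem auxSols_card' (d u v : ℕ) (hd : 1 ≤ d) (hu : 1 ≤ u) (hv : 1 ≤ v) (huv : u.Coprime v) (c : ℤ)
    (hc : c ≠ 0) :
    ((auxSols d u v c).card : ℝ) ≤
      d * auxP (d*u) * auxP (d*v) * (1 / auxP (u*v)) * (1 / auxP c.natAbs) := by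
  classical
  refine (auxSols_card d u v hd hu hv huv c).trans ?_
  have hc' : c.natAbs ≠ 0 := Int.natAbs_ne_zero.2 hc
  have hge : ∀ N : ℕ, ∀ p ∈ N.primeFactors, 0 ≤ 1 - 1/(p:ℝ) := fun N p hp => by
    linarith [(auxP_factor hp).1]
  rw [Finset.prod_mul_distrib]
  have hW : ∏ p ∈ d.primeFactors, (if p ∣ u * v * c.natAbs then 1 else (1 - 1/(p:ℝ))) =
      ∏ p ∈ d.primeFactors.filter (fun p => ¬ p ∣ u * v * c.natAbs), (1 - 1/(p:ℝ)) := by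
    rw [Finset.prod_filter]
    apply Finset.prod_congr rfl
    intro p _
    by_cases h : p ∣ u * v * c.natAbs <;> simp [h]
  rw [hW]
  set W := ∏ p ∈ d.primeFactors.filter (fun p => ¬ p ∣ u * v * c.natAbs), (1 - 1/(p:ℝ)) with hWdef
  have h1 : auxP (d*u) * auxP (d*v) = (∏ p ∈ (d*u*v).primeFactors, (1 - 1/(p:ℝ))) * auxP d := by
    have e1 : (d*u).primeFactors ∪ (d*v).primeFactors = (d*u*v).primeFactors := by
      rw [Nat.primeFactors_mul (by positivity) (by positivity), Nat.primeFactors_mul (by positivity) (by positivity),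
        Nat.primeFactors_mul (by positivity) (by positivity), Nat.primeFactors_mul (by positivity) (by positivity)]
      ext p; simp only [Finset.mem_union]; tauto
    have e2 : (d*u).primeFactors ∩ (d*v).primeFactors = d.primeFactors := by
      rw [← Nat.primeFactors_gcd (by positivity) (by positivity), Nat.gcd_mul_left, huv.gcd_eq_one, mul_one]
    rw [auxP, auxP, auxP, ← Finset.prod_union_inter, e1, e2]
  have h2 : auxP (u*v) * auxP c.natAbs ≤ auxP (u*v*c.natAbs) := by
    rw [auxP, auxP, auxP, ← Finset.prod_union_inter, Nat.primeFactors_mul (by positivity) hc']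
    apply mul_le_of_le_one_right
    · apply Finset.prod_nonneg
      intro p hp
      rw [← Nat.primeFactors_mul (by positivity) hc'] at hp
      exact hge _ p hp
    · apply Finset.prod_le_one
      · intro p hp
        exact hge _ p (Finset.inter_subset_left hp)
      · intro p hp
        exact (auxP_factor (Finset.inter_subset_left hp)).2
  have hW0 : 0 ≤ W := Finset.prod_nonneg fun p hp => hge d p (Finset.filter_subset _ _ hp)
  have h3 : W * auxP (u*v*c.natAbs) ≤ ∏ p ∈ (d*u*v).primeFactors, (1 - 1/(p:ℝ)) := by
    rw [hWdef, auxP, ← Finset.prod_union]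
    · apply aux_prod_mono
      · intro p hp
        rw [Finset.mem_union, Finset.mem_filter]
        have hpp := Nat.prime_of_mem_primeFactors hp
        have hpd := Nat.dvd_of_mem_primeFactors hp
        by_cases h : p ∣ u * v * c.natAbs
        · right
          exact Nat.mem_primeFactors.2 ⟨hpp, h, by positivity⟩
        · left
          refine ⟨Nat.mem_primeFactors.2 ⟨hpp, ?_, by omega⟩, h⟩
          rw [mul_assoc] at hpd
          exact (hpp.dvd_mul.1 hpd).resolve_right fun h' => h (Dvd.dvd.mul_right h' _)
      · intro p hp
        rcases Finset.mem_union.1 hp with hp | hp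
        · exact hge d p (Finset.filter_subset _ _ hp)
        · exact hge _ p hp
    · rw [Finset.disjoint_left]
      intro p hp hp'
      exact (Finset.mem_filter.1 hp).2 (Nat.dvd_of_mem_primeFactors hp')
  have hP1 := auxP_pos (u*v)
  have hP2 := auxP_pos c.natAbs
  have hP3 := auxP_pos d
  have h4 : W * (auxP (u*v) * auxP c.natAbs) ≤ ∏ p ∈ (d*u*v).primeFactors, (1 - 1/(p:ℝ)) :=
    (mul_le_mul_of_nonneg_left h2 hW0).trans h3
  have h5 : W ≤ (∏ p ∈ (d*u*v).primeFactors, (1 - 1/(p:ℝ))) * (1 / auxP (u*v)) * (1 / auxP c.natAbs) := by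
    rw [mul_one_div, mul_one_div, div_div, le_div_iff₀ (by positivity)]
    exact h4
  calc d * (auxP d * W) ≤ d * (auxP d * ((∏ p ∈ (d*u*v).primeFactors, (1 - 1/(p:ℝ))) * (1 / auxP (u*v)) * (1 / auxP c.natAbs))) := by gcongr
    _ = d * (auxP (d*u) * auxP (d*v)) * (1 / auxP (u*v)) * (1 / auxP c.natAbs) := by rw [h1]; ring
    _ = _ := by ring

open Classical in
noncomputable def auxQ (m n : ℕ) (R : ℝ) : Finset (ℕ × ℕ) :=
  Finset.filter (fun x => x.1.Coprime m ∧ x.2.Coprime n ∧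
    ∃ k : ℤ, |(x.1:ℝ) / m - (x.2:ℝ) / n - k| < R) (Finset.Icc 1 m ×ˢ Finset.Icc 1 n)

theorem auxQ_card (d u v : ℕ) (hd : 1 ≤ d) (hu : 1 ≤ u) (hv : 1 ≤ v) (huv : u.Coprime v)
    (hne : u ≠ v) (R : ℝ) (hR : 0 < R) :
    ((auxQ (d*u) (d*v) R).card : ℝ) ≤
      8 * auxP (d*u) * auxP (d*v) * (1 / auxP (u*v)) * (R * (d*u) * (d*v)) := by
  classical
  have hd0 : (0:ℝ) < d := by exact_mod_cast hd
  have hu0 : (0:ℝ) < u := by exact_mod_cast hu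
  have hv0 : (0:ℝ) < v := by exact_mod_cast hv
  set X : ℝ := R * (d*u*v) with hX
  have hX0 : 0 < X := by positivity
  set M := ⌊X⌋₊ with hM
  have hsub : auxQ (d*u) (d*v) R ⊆ (Finset.Icc 1 M).biUnion
      (fun i => auxSols d u v i ∪ auxSols d u v (-i)) := by
    rintro ⟨a, b⟩ hx
    simp only [auxQ, Finset.mem_filter, Finset.mem_product, Finset.mem_Icc] at hx
    obtain ⟨hr, hca, hcb, k, hk⟩ := hx
    set c : ℤ := a * v - b * u - k * (d * u * v) with hc
    have hcR : |(c:ℝ)| < X := by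
      have e : (c:ℝ) = ((a:ℝ) / (d*u : ℕ) - (b:ℝ) / (d*v : ℕ) - k) * (d*u*v) := by
        rw [hc]; push_cast
        field_simp
      rw [e, abs_mul, abs_of_pos (by positivity : (0:ℝ) < d*u*v), hX]
      gcongr
    have hc0 : c ≠ 0 := by
      intro h
      apply hne
      have hcop : IsCoprime (u:ℤ) (v:ℤ) := Nat.isCoprime_iff_coprime.2 huv
      have h1 : (u:ℤ) ∣ a := by
        apply hcop.dvd_of_dvd_mul_right
        exact ⟨b + k * d * v, by linear_combination h⟩
      have h2 : (v:ℤ) ∣ b := by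
        apply hcop.symm.dvd_of_dvd_mul_right
        exact ⟨a - k * d * u, by linear_combination -h⟩
      have h3 := Nat.eq_one_of_dvd_coprimes hca (by exact_mod_cast h1) (Dvd.intro_left d rfl)
      have h4 := Nat.eq_one_of_dvd_coprimes hcb (by exact_mod_cast h2) (Dvd.intro_left d rfl)
      rw [h3, h4]
    have hmem : ((a, b) : ℕ × ℕ) ∈ auxSols d u v c := by
      simp only [auxSols, Finset.mem_filter, Finset.mem_product, Finset.mem_Icc]
      refine ⟨hr, hca, hcb, k, ?_⟩
      rw [hc]; push_cast; ring
    rw [Finset.mem_biUnion]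
    refine ⟨c.natAbs, ?_, ?_⟩
    · rw [Finset.mem_Icc]
      refine ⟨Int.natAbs_pos.2 hc0, ?_⟩
      rw [hM]
      apply Nat.le_floor
      rw [Nat.cast_natAbs]
      push_cast
      exact hcR.le
    · rw [Finset.mem_union]
      rcases Int.natAbs_eq c with h | h
      · left; rw [← h]; exact hmem
      · right; rw [← h]; exact hmem
  set K := d * auxP (d*u) * auxP (d*v) * (1 / auxP (u*v)) with hK
  have hK0 : 0 ≤ K := by
    have := auxP_pos (d*u)
    have := auxP_pos (d*v)
    have := auxP_pos (u*v)
    positivity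
  have h1 : (auxQ (d*u) (d*v) R).card ≤ ∑ i ∈ Finset.Icc 1 M,
      ((auxSols d u v i).card + (auxSols d u v (-i)).card) :=
    (Finset.card_le_card hsub).trans (Finset.card_biUnion_le.trans
      (Finset.sum_le_sum fun i _ => Finset.card_union_le _ _))
  calc ((auxQ (d*u) (d*v) R).card : ℝ) ≤ ((∑ i ∈ Finset.Icc 1 M,
      ((auxSols d u v i).card + (auxSols d u v (-i)).card) : ℕ) : ℝ) := by exact_mod_cast h1
    _ ≤ ∑ i ∈ Finset.Icc 1 M, 2 * K * (1 / auxP i) := by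
      push_cast
      apply Finset.sum_le_sum
      intro i hi
      rw [Finset.mem_Icc] at hi
      have h2 := auxSols_card' d u v hd hu hv huv i (by omega)
      have h3 := auxSols_card' d u v hd hu hv huv (-i) (by omega)
      rw [Int.natAbs_neg] at h3
      rw [Int.natAbs_natCast] at h2 h3
      rw [← hK] at h2 h3
      linarith
    _ = 2 * K * ∑ i ∈ Finset.Icc 1 M, 1 / auxP i := by rw [Finset.mul_sum]
    _ ≤ 2 * K * (4 * X) := by
      have h2 := auxP_sum M
      have h3 : (M:ℝ) ≤ X := Nat.floor_le hX0.le
      gcongr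
      linarith
    _ = _ := by rw [hK, hX]; ring

theorem aux_image_ball (x r : ℝ) :
    (fun x : ℝ => (x : UnitAddCircle)) '' Set.Ioo (x - r) (x + r) = Metric.ball (x : UnitAddCircle) r := by
  ext y
  constructor
  · rintro ⟨z, hz, rfl⟩
    rw [Metric.mem_ball, dist_eq_norm]
    simp only
    rw [← AddCircle.coe_sub, UnitAddCircle.norm_eq]
    have := round_le (z - x) 0
    simp only [Int.cast_zero, sub_zero] at this
    refine this.trans_lt ?_
    rw [abs_lt]; constructor <;> linarith [hz.1, hz.2]
  · intro h
    obtain ⟨z, rfl⟩ := QuotientAddGroup.mk_surjective y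
    rw [Metric.mem_ball, dist_eq_norm] at h
    change ‖((z:ℝ) : UnitAddCircle) - (x : UnitAddCircle)‖ < r at h
    rw [← AddCircle.coe_sub, UnitAddCircle.norm_eq, abs_lt] at h
    refine ⟨z - round (z - x), ⟨by linarith [h.1], by linarith [h.2]⟩, ?_⟩
    change ((z - round (z - x) : ℝ) : UnitAddCircle) = (z : UnitAddCircle)
    rw [AddCircle.coe_sub]
    have : ((round (z - x) : ℝ) : UnitAddCircle) = 0 := by
      rw [AddCircle.coe_eq_zero_iff]
      exact ⟨round (z - x), by simp⟩
    rw [this, sub_zero]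

theorem aux_vol_ball (x : UnitAddCircle) (r : ℝ) (hr : 2 * r ≤ 1) :
    volume (Metric.ball x r) = ENNReal.ofReal (2 * r) := by
  rw [← measure_congr (AddCircle.closedBall_ae_eq_ball), AddCircle.volume_closedBall, min_eq_right hr]

theorem aux_approx (ψ : ℕ → ℝ) (n : ℕ) :
    approxSet ψ n = ⋃ a ∈ (Finset.Icc 1 n).filter (fun a => a.Coprime n),
      Metric.ball (((a:ℝ) / n : ℝ) : UnitAddCircle) (ψ n / n) := by
  rw [approxSet]
  ext y
  simp only [Set.mem_iUnion, Set.mem_ofPred_eq, Finset.mem_filter, Finset.mem_Icc, exists_prop, ← aux_image_ball,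
    sub_div, add_div, Nat.Coprime, and_assoc]

theorem aux_vol (ψ : ℕ → ℝ) (n : ℕ) (hn : 1 ≤ n) (h0 : 0 < ψ n) (h1 : ψ n ≤ 1/2) :
    (volume (approxSet ψ n)).toReal = 2 * ψ n * auxP n := by
  have hn0 : (0:ℝ) < n := by exact_mod_cast hn
  have hn1 : (1:ℝ) ≤ n := by exact_mod_cast hn
  have hr : 2 * (ψ n / n) ≤ 1 / n := by
    rw [← mul_div_assoc]
    gcongr
    linarith
  have hr' : 2 * (ψ n / n) ≤ 1 := hr.trans (by rw [div_le_one hn0]; exact hn1)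
  rw [aux_approx, measure_biUnion_finset]
  · simp only [aux_vol_ball _ _ hr', Finset.sum_const, nsmul_eq_mul]
    rw [ENNReal.toReal_mul, ENNReal.toReal_natCast, ENNReal.toReal_ofReal (by positivity)]
    have : ((Finset.Icc 1 n).filter (fun a => a.Coprime n)).card = n.totient := by
      rw [← Nat.filter_coprime_Ico_eq_totient n 1]
      congr 1
      ext a
      simp only [Finset.mem_filter, Finset.mem_Icc, Finset.mem_Ico, Nat.coprime_comm (n := n)]
      constructor
      · rintro ⟨h1, h2⟩; exact ⟨by omega, h2⟩
      · rintro ⟨h1, h2⟩; exact ⟨by omega, h2⟩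
    rw [this, auxP_totient]
    field_simp
  · intro a ha b hb hab
    simp only [Finset.coe_filter, Finset.mem_Icc, Set.mem_ofPred_eq] at ha hb
    apply Metric.ball_disjoint_ball
    rw [← two_mul]
    refine hr.trans ?_
    rw [dist_eq_norm, ← AddCircle.coe_sub, UnitAddCircle.norm_eq]
    set k := round ((a:ℝ)/n - b/n)
    have e : (a:ℝ)/n - b/n - k = ((a - b - k * n : ℤ):ℝ) / n := by
      push_cast; field_simp
    rw [e, abs_div, abs_of_pos hn0]
    gcongr
    have hz : (a - b - k * n : ℤ) ≠ 0 := by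
      intro h
      have h5 : (n:ℤ) ∣ (a:ℤ) - b := ⟨k, by linear_combination h⟩
      have h6 : (a:ℤ) - b = 0 := by
        apply Int.eq_zero_of_abs_lt_dvd h5
        rw [abs_lt]; constructor <;> omega
      omega
    exact_mod_cast Int.one_le_abs hz
  · intro a _
    exact Metric.isOpen_ball.measurableSet

theorem aux_overlap (ψ : ℕ → ℝ) (m n : ℕ) (hm : 1 ≤ m) (hn : 1 ≤ n)
    (h0m : 0 < ψ m) (h1m : ψ m ≤ 1/2) (h0n : 0 < ψ n) (h1n : ψ n ≤ 1/2) :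
    (volume (approxSet ψ m ∩ approxSet ψ n)).toReal ≤
      (auxQ m n (ψ m / m + ψ n / n)).card * (2 * min (ψ m / m) (ψ n / n)) := by
  have hm0 : (0:ℝ) < m := by exact_mod_cast hm
  have hn0 : (0:ℝ) < n := by exact_mod_cast hn
  have hn1 : (1:ℝ) ≤ n := by exact_mod_cast hn
  have hm1 : (1:ℝ) ≤ m := by exact_mod_cast hm
  have hrm : 2 * (ψ m / m) ≤ 1 := by
    rw [← mul_div_assoc, div_le_one hm0]; linarith
  have hrn : 2 * (ψ n / n) ≤ 1 := by
    rw [← mul_div_assoc, div_le_one hn0]; linarith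
  set δ := min (ψ m / m) (ψ n / n) with hδ
  have hδ0 : 0 < δ := lt_min (by positivity) (by positivity)
  have hsub : approxSet ψ m ∩ approxSet ψ n ⊆ ⋃ x ∈ auxQ m n (ψ m / m + ψ n / n),
      (Metric.ball (((x.1:ℝ) / m : ℝ) : UnitAddCircle) (ψ m / m) ∩
        Metric.ball (((x.2:ℝ) / n : ℝ) : UnitAddCircle) (ψ n / n)) := by
    rintro y ⟨h1, h2⟩
    rw [aux_approx] at h1 h2
    simp only [Set.mem_iUnion, Finset.mem_filter, Finset.mem_Icc, exists_prop] at h1 h2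
    obtain ⟨a, ⟨ha, hca⟩, hya⟩ := h1
    obtain ⟨b, ⟨hb, hcb⟩, hyb⟩ := h2
    simp only [Set.mem_iUnion, exists_prop]
    refine ⟨(a, b), ?_, hya, hyb⟩
    simp only [auxQ, Finset.mem_filter, Finset.mem_product, Finset.mem_Icc]
    refine ⟨⟨ha, hb⟩, hca, hcb, round ((a:ℝ)/m - b/n), ?_⟩
    rw [← UnitAddCircle.norm_eq, AddCircle.coe_sub, ← dist_eq_norm]
    rw [Metric.mem_ball'] at hya
    rw [Metric.mem_ball] at hyb
    exact (dist_triangle _ y _).trans_lt (add_lt_add hya hyb)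
  have hle : volume (approxSet ψ m ∩ approxSet ψ n) ≤
      (auxQ m n (ψ m / m + ψ n / n)).card * ENNReal.ofReal (2 * δ) := by
    refine (measure_mono hsub).trans ((measure_biUnion_finset_le _ _).trans ?_)
    rw [← nsmul_eq_mul, ← Finset.sum_const]
    apply Finset.sum_le_sum
    intro x _
    rcases min_choice (ψ m / m) (ψ n / n) with h | h
    · rw [hδ, h, ← aux_vol_ball _ _ hrm]
      exact measure_mono Set.inter_subset_left
    · rw [hδ, h, ← aux_vol_ball _ _ hrn]
      exact measure_mono Set.inter_subset_right
  have := ENNReal.toReal_mono (by finiteness) hle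
  rwa [ENNReal.toReal_mul, ENNReal.toReal_natCast, ENNReal.toReal_ofReal (by positivity)] at this

/-- For `m ≠ n` in the same block `Δ_h = {2^{2^h}+1, …, 2^{2^{h+1}}}`, the overlap
is at most `ĉ h λ(E_m) λ(E_n)` for an absolute constant `ĉ`. -/
theorem overlap_same_block :
    ∃ chat : ℝ, 0 < chat ∧ ∀ ψ : ℕ → ℝ, (∀ k, 0 < ψ k ∧ ψ k ≤ 1 / 2) →
      ∀ h : ℕ, 1 ≤ h →
        ∀ m ∈ Finset.Icc (2 ^ 2 ^ h + 1) (2 ^ 2 ^ (h + 1)),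
          ∀ n ∈ Finset.Icc (2 ^ 2 ^ h + 1) (2 ^ 2 ^ (h + 1)), m ≠ n →
            (volume (approxSet ψ m ∩ approxSet ψ n)).toReal ≤
              chat * h * (volume (approxSet ψ m)).toReal *
                (volume (approxSet ψ n)).toReal := by
  refine ⟨48 * Real.exp 9, by positivity, ?_⟩
  intro ψ hψ h hh m hm n hn hmn
  rw [Finset.mem_Icc] at hm hn
  have hm1 : 1 ≤ m := (Nat.le_add_left 1 _).trans hm.1
  have hn1 : 1 ≤ n := (Nat.le_add_left 1 _).trans hn.1
  obtain ⟨h0m, h1m⟩ := hψ m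
  obtain ⟨h0n, h1n⟩ := hψ n
  have hm0 : (0:ℝ) < m := by exact_mod_cast hm1
  have hn0 : (0:ℝ) < n := by exact_mod_cast hn1
  rw [aux_vol ψ m hm1 h0m h1m, aux_vol ψ n hn1 h0n h1n]
  refine (aux_overlap ψ m n hm1 hn1 h0m h1m h0n h1n).trans ?_
  obtain ⟨d, u, v, hd, hu, hv, huv, hmd, hnd⟩ : ∃ d u v : ℕ, 1 ≤ d ∧ 1 ≤ u ∧ 1 ≤ v ∧ u.Coprime v ∧
      m = d * u ∧ n = d * v := by
    obtain ⟨u, v, huv, h1, h2⟩ := Nat.exists_coprime m n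
    refine ⟨m.gcd n, u, v, Nat.gcd_pos_of_pos_left _ hm1, ?_, ?_, huv, by rw [mul_comm]; exact h1, by rw [mul_comm]; exact h2⟩
    · rcases Nat.eq_zero_or_pos u with h | h
      · rw [h] at h1; omega
      · exact h
    · rcases Nat.eq_zero_or_pos v with h | h
      · rw [h] at h2; omega
      · exact h
  have hne : u ≠ v := by rintro rfl; exact hmn (hmd.trans hnd.symm)
  set R := ψ m / m + ψ n / n with hR
  set δ := min (ψ m / m) (ψ n / n) with hδ
  have hδ0 : 0 < δ := lt_min (by positivity) (by positivity)
  have hR0 : 0 < R := by positivity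
  have hQ := auxQ_card d u v hd hu hv huv hne R hR0
  rw [← hmd, ← hnd] at hQ
  have hQ' : ((auxQ m n R).card : ℝ) ≤ 8 * auxP m * auxP n * (1 / auxP (u*v)) * (R * m * n) := by
    refine hQ.trans (le_of_eq ?_)
    rw [show (m:ℝ) = d * u by rw [hmd]; push_cast; rfl, show (n:ℝ) = d * v by rw [hnd]; push_cast; rfl]
  have huvle : u * v ≤ 2 ^ 2 ^ (h+2) := by
    have h1 : u ≤ m := by rw [hmd]; exact Nat.le_mul_of_pos_left u hd
    have h2 : v ≤ n := by rw [hnd]; exact Nat.le_mul_of_pos_left v hd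
    calc u * v ≤ 2 ^ 2 ^ (h+1) * 2 ^ 2 ^ (h+1) := Nat.mul_le_mul (h1.trans hm.2) (h2.trans hn.2)
      _ = 2 ^ 2 ^ (h+2) := by rw [← pow_add]; congr 1; ring
  have hlog := auxP_inv_loglog (u*v) (h+2) (by omega) (Nat.mul_pos hu hv) huvle
  have hlog' : 1 / auxP (u*v) ≤ 6 * Real.exp 9 * h := by
    refine hlog.trans ?_
    have : (1:ℝ) ≤ h := by exact_mod_cast hh
    have he := Real.exp_pos 9
    push_cast
    nlinarith
  have hδR : δ * R * m * n ≤ 2 * (ψ m * ψ n) := by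
    have h1 : δ ≤ ψ m / m := min_le_left _ _
    have h2 : δ ≤ ψ n / n := min_le_right _ _
    have h3 : δ * R ≤ 2 * ((ψ m / m) * (ψ n / n)) := by
      have a1 : 0 < ψ m / m := by positivity
      have a2 : 0 < ψ n / n := by positivity
      rw [hR]
      nlinarith
    calc δ * R * m * n ≤ 2 * ((ψ m / m) * (ψ n / n)) * m * n := by gcongr
      _ = _ := by field_simp
  have hPm := auxP_pos m
  have hPn := auxP_pos n
  have hPuv := auxP_pos (u*v)
  calc ((auxQ m n R).card : ℝ) * (2 * δ)
      ≤ 8 * auxP m * auxP n * (1 / auxP (u*v)) * (R * m * n) * (2 * δ) := by gcongr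
    _ = 16 * auxP m * auxP n * (1 / auxP (u*v)) * (δ * R * m * n) := by ring
    _ ≤ 16 * auxP m * auxP n * (6 * Real.exp 9 * h) * (2 * (ψ m * ψ n)) := by gcongr
    _ = _ := by ring
end

section
/- There exists an absolute constant C > 0 such that the following holds. Let ψ : ℕ → ℝ satisfy, whenever ψ(k) ≠ 0, that 1/k ≤ ψ(k) ≤ 1/2. Let h_1 < h_2 be positive integers, m ∈ Δ_{3h_1} = {2^{2^{3h_1}}+1, …, 2^{2^{3h_1+1}}} and n ∈ Δ_{3h_2} = {2^{2^{3h_2}}+1, …, 2^{2^{3h_2+1}}}. Then λ(E_m ∩ E_n) ≤ C · λ(E_m) λ(E_n). -/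
open MeasureTheory

theorem sieve_aux (S : Finset ℕ) (hS : ∀ p ∈ S, p.Prime) : ∀ x y : ℝ, x ≤ y →
    |(((Finset.Ioc ⌊x⌋ ⌊y⌋).filter (fun k : ℤ => ∀ p ∈ S, ¬ (p : ℤ) ∣ k)).card : ℝ)
      - (y - x) * ∏ p ∈ S, (1 - (p : ℝ)⁻¹)| ≤ 2 ^ S.card := by
  induction S using Finset.induction_on with
  | empty =>
    intro x y hxy
    have h1 := Int.floor_le x
    have h2 := Int.lt_floor_add_one x
    have h3 := Int.floor_le y
    have h4 := Int.lt_floor_add_one y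
    have h5 : ⌊x⌋ ≤ ⌊y⌋ := Int.floor_mono hxy
    have h6 : (((⌊y⌋ - ⌊x⌋).toNat : ℕ) : ℝ) = (⌊y⌋ : ℝ) - ⌊x⌋ := by
      have : (((⌊y⌋ - ⌊x⌋).toNat : ℕ) : ℤ) = ⌊y⌋ - ⌊x⌋ := Int.toNat_of_nonneg (by omega)
      exact_mod_cast this
    simp only [Finset.notMem_empty, false_imp_iff, implies_true, Finset.filter_true,
      Int.card_Ioc, h6, Finset.prod_empty, Finset.card_empty, pow_zero, abs_le]
    constructor <;> linarith
  | insert p S hp ih =>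
    intro x y hxy
    have hpp : p.Prime := hS p (by simp)
    have hS' : ∀ q ∈ S, q.Prime := fun q hq => hS q (by simp [hq])
    have hp0 : (0 : ℝ) < p := by exact_mod_cast hpp.pos
    have i1 := ih hS' x y hxy
    have i2 := ih hS' (x / p) (y / p) (by gcongr)
    have key : ((Finset.Ioc ⌊x⌋ ⌊y⌋).filter (fun k : ℤ => ∀ q ∈ S, ¬ (q : ℤ) ∣ k)).card
        = ((Finset.Ioc ⌊x⌋ ⌊y⌋).filter (fun k : ℤ => ∀ q ∈ insert p S, ¬ (q : ℤ) ∣ k)).card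
        + ((Finset.Ioc ⌊x / p⌋ ⌊y / p⌋).filter (fun k : ℤ => ∀ q ∈ S, ¬ (q : ℤ) ∣ k)).card := by
      rw [← Finset.card_filter_add_card_filter_not (s := (Finset.Ioc ⌊x⌋ ⌊y⌋).filter (fun k : ℤ => ∀ q ∈ S, ¬ (q : ℤ) ∣ k)) (fun k : ℤ => ¬ (p : ℤ) ∣ k)]
      congr 1
      · congr 1
        ext k
        simp only [Finset.mem_filter, Finset.mem_insert, forall_eq_or_imp]
        tauto
      · symm
        apply Finset.card_bij (fun k _ => (p : ℤ) * k)
        · intro k hk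
          simp only [Finset.mem_filter, Finset.mem_Ioc, Int.floor_lt, Int.le_floor, not_not] at hk ⊢
          obtain ⟨⟨hk1, hk2⟩, hk3⟩ := hk
          rw [div_lt_iff₀ hp0] at hk1
          rw [le_div_iff₀ hp0] at hk2
          refine ⟨⟨⟨by push_cast; linarith, by push_cast; linarith⟩, ?_⟩, dvd_mul_right _ _⟩
          intro q hq hd
          have hqp : (q : ℤ) ∣ p ∨ (q : ℤ) ∣ k :=
            (Nat.prime_iff_prime_int.mp (hS' q hq)).dvd_or_dvd hd
          rcases hqp with h | h
          · have h' : q ∣ p := by exact_mod_cast h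
            have := (Nat.prime_dvd_prime_iff_eq (hS' q hq) hpp).mp h'
            exact hp (this ▸ hq)
          · exact hk3 q hq h
        · intro a _ b _ h
          have : (p : ℤ) ≠ 0 := by exact_mod_cast hpp.ne_zero
          exact mul_left_cancel₀ this h
        · intro b hb
          simp only [Finset.mem_filter, Finset.mem_Ioc, Int.floor_lt, Int.le_floor, not_not] at hb
          obtain ⟨⟨⟨hb1, hb2⟩, hb3⟩, k, rfl⟩ := hb
          push_cast at hb1 hb2
          refine ⟨k, ?_, rfl⟩
          simp only [Finset.mem_filter, Finset.mem_Ioc, Int.floor_lt, Int.le_floor]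
          rw [div_lt_iff₀ hp0, le_div_iff₀ hp0]
          exact ⟨⟨by linarith, by linarith⟩, fun q hq h => hb3 q hq (h.mul_left _)⟩
    have key' := congrArg (Nat.cast : ℕ → ℝ) key
    push_cast at key'
    rw [Finset.prod_insert hp, Finset.card_insert_of_notMem hp, pow_succ]
    rw [abs_le] at *
    have e : (y / p - x / p) * ∏ p ∈ S, (1 - (p : ℝ)⁻¹) = (y - x) * ((p : ℝ)⁻¹ * ∏ p ∈ S, (1 - (p : ℝ)⁻¹)) := by
      field_simp
    rw [e] at i2
    have e2 : (y - x) * ((1 - (p : ℝ)⁻¹) * ∏ p ∈ S, (1 - (p : ℝ)⁻¹)) =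
      (y - x) * ∏ p ∈ S, (1 - (p : ℝ)⁻¹) - (y - x) * ((p : ℝ)⁻¹ * ∏ p ∈ S, (1 - (p : ℝ)⁻¹)) := by ring
    rw [e2]
    constructor <;> linarith [i1.1, i1.2, i2.1, i2.2]

theorem totient_prod (n : ℕ) : (n.totient : ℝ) = n * ∏ p ∈ n.primeFactors, (1 - (p : ℝ)⁻¹) := by
  have := Nat.totient_eq_mul_prod_factors n
  have h := congrArg (Rat.cast : ℚ → ℝ) this
  push_cast at h
  exact h

theorem omega_bound (n : ℕ) (hn : 0 < n) :
    (2 : ℝ) ^ n.primeFactors.card ≤ 2187 * √n * ∏ p ∈ n.primeFactors, (1 - (p : ℝ)⁻¹) := by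
  have h1 : ∏ p ∈ n.primeFactors, √(p : ℝ) ≤ √n := by
    rw [← Real.sqrt_prod _ (fun _ _ => by positivity)]
    apply Real.sqrt_le_sqrt
    have := Nat.le_of_dvd hn (Nat.prod_primeFactors_dvd n)
    have h := (Nat.cast_le (α := ℝ)).mpr this
    rwa [Nat.cast_prod] at h
  have h2 : ∀ p ∈ n.primeFactors, (2 : ℝ) ≤ (if p < 7 then 3 else 1) * (√(p : ℝ) * (1 - (p : ℝ)⁻¹)) := by
    intro p hp
    have hpp := Nat.prime_of_mem_primeFactors hp
    have hp2 : (2 : ℝ) ≤ p := by exact_mod_cast hpp.two_le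
    have hs : √(p : ℝ) * (1 - (p : ℝ)⁻¹) = √p - (√p)⁻¹ := by
      have h0 : 0 < √(p : ℝ) := by positivity
      have h3 : (p : ℝ) = √p * √p := (Real.mul_self_sqrt (by positivity)).symm
      have : √(p : ℝ) * (p : ℝ)⁻¹ = (√p)⁻¹ := by
        conv_lhs => rw [h3]
        rw [Real.sqrt_mul_self h0.le]
        field_simp
      rw [mul_sub, this, mul_one]
    rw [hs]
    split_ifs with h
    · have ha : (1.41 : ℝ) ≤ √p := Real.le_sqrt_of_sq_le (by linarith)
      have hb : (√(p : ℝ))⁻¹ ≤ (1.41 : ℝ)⁻¹ := by gcongr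
      norm_num at ha hb ⊢
      linarith
    · have h7 : (7 : ℝ) ≤ p := by exact_mod_cast not_lt.mp h
      have ha : (2.5 : ℝ) ≤ √p := Real.le_sqrt_of_sq_le (by linarith)
      have hb : (√(p : ℝ))⁻¹ ≤ (2.5 : ℝ)⁻¹ := by gcongr
      norm_num at ha hb ⊢
      linarith
  have h3 : ∏ p ∈ n.primeFactors, (if p < 7 then (3 : ℝ) else 1) ≤ 2187 := by
    rw [← Finset.prod_filter, Finset.prod_const]
    have : (n.primeFactors.filter (· < 7)).card ≤ 7 := by
      calc _ ≤ (Finset.range 7).card := Finset.card_le_card (by intro p; simp)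
        _ = 7 := by simp
    calc (3 : ℝ) ^ _ ≤ 3 ^ 7 := pow_le_pow_right₀ (by norm_num) this
      _ = 2187 := by norm_num
  have h4 : 0 ≤ ∏ p ∈ n.primeFactors, (1 - (p : ℝ)⁻¹) := by
    apply Finset.prod_nonneg
    intro p hp
    have hpp := Nat.prime_of_mem_primeFactors hp
    have hp2 : (1 : ℝ) ≤ p := by exact_mod_cast hpp.one_le
    linarith [inv_le_one_of_one_le₀ hp2]
  calc (2 : ℝ) ^ n.primeFactors.card = ∏ p ∈ n.primeFactors, (2 : ℝ) := by simp
    _ ≤ ∏ p ∈ n.primeFactors, ((if p < 7 then 3 else 1) * (√(p : ℝ) * (1 - (p : ℝ)⁻¹))) :=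
      Finset.prod_le_prod (fun _ _ => by norm_num) h2
    _ = (∏ p ∈ n.primeFactors, (if p < 7 then (3 : ℝ) else 1)) * (∏ p ∈ n.primeFactors, √(p : ℝ)) * ∏ p ∈ n.primeFactors, (1 - (p : ℝ)⁻¹) := by
      rw [Finset.prod_mul_distrib, Finset.prod_mul_distrib]; ring
    _ ≤ _ := by gcongr

theorem count_bound (n : ℕ) (hn : 0 < n) (x y X : ℝ) (hxy : x ≤ y) (hX : y - x ≤ X + 1)
    (hnX : 2 * √n ≤ X) :
    (((Finset.Ioc ⌊x⌋ ⌊y⌋).filter (fun k : ℤ => IsCoprime k (n : ℤ))).card : ℝ)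
      ≤ 3000 * X * (n.totient / n) := by
  have h1 := (abs_le.mp (sieve_aux n.primeFactors (fun p => Nat.prime_of_mem_primeFactors) x y hxy)).2
  have hn0 : (0 : ℝ) < n := by exact_mod_cast hn
  have h2 : ((Finset.Ioc ⌊x⌋ ⌊y⌋).filter (fun k : ℤ => IsCoprime k (n : ℤ))).card ≤
      ((Finset.Ioc ⌊x⌋ ⌊y⌋).filter (fun k : ℤ => ∀ p ∈ n.primeFactors, ¬ (p : ℤ) ∣ k)).card := by
    apply Finset.card_le_card
    intro k
    simp only [Finset.mem_filter]
    rintro ⟨hk, hc⟩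
    refine ⟨hk, fun p hp hd => ?_⟩
    have hpp := Nat.prime_of_mem_primeFactors hp
    have hpn : (p : ℤ) ∣ n := by exact_mod_cast Nat.dvd_of_mem_primeFactors hp
    have := hc.isUnit_of_dvd' hd hpn
    exact (Nat.prime_iff_prime_int.mp hpp).not_isUnit this
  have h2' : (((Finset.Ioc ⌊x⌋ ⌊y⌋).filter (fun k : ℤ => IsCoprime k (n : ℤ))).card : ℝ) ≤ (((Finset.Ioc ⌊x⌋ ⌊y⌋).filter (fun k : ℤ => ∀ p ∈ n.primeFactors, ¬ (p : ℤ) ∣ k)).card : ℝ) := by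
    exact_mod_cast h2
  have h3 : (n.totient : ℝ) / n = ∏ p ∈ n.primeFactors, (1 - (p : ℝ)⁻¹) := by
    rw [totient_prod]; field_simp
  have h4 := omega_bound n hn
  rw [← h3] at h1 h4
  have h5 : (0 : ℝ) ≤ n.totient / n := by positivity
  have h6 : (1 : ℝ) ≤ √n := by
    rw [Real.one_le_sqrt]; exact_mod_cast hn
  generalize (n.totient : ℝ) / n = t at *
  have h7 : (y - x) * t ≤ (2 * X) * t := by
    apply mul_le_mul_of_nonneg_right _ h5; linarith
  have h8 : 2187 * √n * t ≤ 1100 * X * t := by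
    apply mul_le_mul_of_nonneg_right _ h5; linarith
  have h9 : 0 ≤ X * t := mul_nonneg (by linarith) h5
  linarith

theorem vol_image (c r : ℝ) :
    volume ((fun x : ℝ => (x : UnitAddCircle)) '' Set.Ioo (c - r) (c + r)) ≤ ENNReal.ofReal (2 * r) := by
  have : (fun x : ℝ => (x : UnitAddCircle)) '' Set.Ioo (c - r) (c + r) ⊆ Metric.closedBall (c : UnitAddCircle) r := by
    rintro _ ⟨x, hx, rfl⟩
    rw [Metric.mem_closedBall, dist_eq_norm, ← AddCircle.coe_sub]
    refine (QuotientAddGroup.norm_mk_le_norm).trans ?_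
    rw [Real.norm_eq_abs]
    rw [abs_le]
    constructor <;> linarith [hx.1, hx.2]
  refine (measure_mono this).trans ?_
  rw [AddCircle.volume_closedBall]
  exact ENNReal.ofReal_le_ofReal (min_le_right _ _)

theorem totient_card (n : ℕ) (hn : 1 < n) :
    ((Finset.Icc 1 n).filter (fun a => Nat.gcd a n = 1)).card = n.totient := by
  rw [Nat.totient_eq_card_coprime]
  congr 1
  ext a
  simp only [Finset.mem_filter, Finset.mem_Icc, Finset.mem_range, Nat.Coprime, Nat.gcd_comm n a]
  constructor
  · rintro ⟨⟨h1, h2⟩, h3⟩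
    refine ⟨lt_of_le_of_ne h2 ?_, h3⟩
    rintro rfl
    rw [Nat.gcd_self] at h3
    omega
  · rintro ⟨h1, h3⟩
    refine ⟨⟨Nat.one_le_iff_ne_zero.mpr ?_, h1.le⟩, h3⟩
    rintro rfl
    rw [Nat.gcd_zero_left] at h3
    omega

theorem vol_lower (ψ : ℕ → ℝ) (n : ℕ) (hn : 1 < n) (h0 : 0 < ψ n) (h1 : ψ n ≤ 1 / 2) :
    n.totient * (2 * (ψ n / n)) ≤ (volume (approxSet ψ n)).toReal := by
  have hn0 : (0 : ℝ) < n := by exact_mod_cast (by omega : 0 < n)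
  set A := (Finset.Icc 1 n).filter (fun a => Nat.gcd a n = 1) with hA
  set J : ℕ → Set ℝ := fun a => Set.Ioo (((a : ℝ) - ψ n) / n) (((a : ℝ) + ψ n) / n) with hJ
  have hopen : IsOpen (approxSet ψ n) := by
    unfold approxSet
    refine isOpen_biUnion fun a _ => ?_
    exact QuotientAddGroup.isOpenMap_coe _ isOpen_Ioo
  have hmp := AddCircle.measurePreserving_mk 1 (1 / (2 * n : ℝ))
  have hv : volume (approxSet ψ n) = volume.restrict (Set.Ioc (1 / (2 * n : ℝ)) (1 / (2 * n : ℝ) + 1)) ((fun x : ℝ => (x : UnitAddCircle)) ⁻¹' approxSet ψ n) :=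
    (hmp.measure_preimage hopen.measurableSet.nullMeasurableSet).symm
  have hsub : (⋃ a ∈ A, J a) ⊆ ((fun x : ℝ => (x : UnitAddCircle)) ⁻¹' approxSet ψ n) ∩ Set.Ioc (1 / (2 * n : ℝ)) (1 / (2 * n : ℝ) + 1) := by
    intro x hx
    simp only [Set.mem_iUnion] at hx
    obtain ⟨a, ha, hx⟩ := hx
    simp only [hA, Finset.mem_filter, Finset.mem_Icc] at ha
    refine ⟨?_, ?_⟩
    · simp only [approxSet, Set.mem_preimage, Set.mem_iUnion]
      exact ⟨a, ⟨ha.1.1, ha.1.2, ha.2⟩, x, hx, rfl⟩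
    · have ha1 : (1 : ℝ) ≤ a := by exact_mod_cast ha.1.1
      have ha2 : (a : ℝ) ≤ n := by exact_mod_cast ha.1.2
      constructor
      · refine lt_of_le_of_lt ?_ hx.1
        rw [div_le_div_iff₀ (by positivity) hn0]
        nlinarith
      · refine hx.2.le.trans ?_
        have : 1 / (2 * n : ℝ) + 1 = (n + 1 / 2) / n := by field_simp; ring
        rw [this]
        gcongr
  have hdisj : Set.PairwiseDisjoint (A : Set ℕ) J := by
    have aux : ∀ a b : ℕ, a < b → Disjoint (J a) (J b) := by
      intro a b hab
      rw [Set.disjoint_left]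
      intro x hx hy
      have hab' : (a : ℝ) + 1 ≤ b := by exact_mod_cast hab
      have h2 := hy.1.trans hx.2
      rw [div_lt_div_iff_of_pos_right hn0] at h2
      linarith
    intro a _ b _ hab
    rcases lt_or_gt_of_ne hab with h | h
    · exact aux a b h
    · exact (aux b a h).symm
  have hvol : volume (⋃ a ∈ A, J a) = ENNReal.ofReal (n.totient * (2 * (ψ n / n))) := by
    rw [measure_biUnion_finset hdisj (fun _ _ => measurableSet_Ioo)]
    have : ∀ a ∈ A, volume (J a) = ENNReal.ofReal (2 * (ψ n / n)) := by
      intro a _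
      rw [hJ, Real.volume_Ioo]
      congr 1
      field_simp; ring
    rw [Finset.sum_congr rfl this, Finset.sum_const, totient_card n hn, nsmul_eq_mul,
      ENNReal.ofReal_mul (p := (n.totient : ℝ)) (by positivity), ENNReal.ofReal_natCast]
  have hle : ENNReal.ofReal (n.totient * (2 * (ψ n / n))) ≤ volume (approxSet ψ n) := by
    rw [← hvol, hv]
    rw [Measure.restrict_apply' measurableSet_Ioc]
    exact measure_mono hsub
  exact (ENNReal.ofReal_le_iff_le_toReal (measure_ne_top _ _)).mp hle

theorem vol_upper (ψ : ℕ → ℝ) (m n : ℕ) (hm : 1 < m) (hmn : m ^ 4 ≤ n)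
    (m0 : 1 / (m : ℝ) ≤ ψ m) (n0 : 0 < ψ n) (n1 : ψ n ≤ 1 / 2) :
    (volume (approxSet ψ m ∩ approxSet ψ n)).toReal ≤
      m.totient * (3000 * (n * (2 * (ψ m / m))) * (n.totient / n) * (2 * (ψ n / n))) := by
  have hm0 : (0 : ℝ) < m := by exact_mod_cast (by omega : 0 < m)
  have hn : 0 < n := lt_of_lt_of_le (by positivity) hmn
  have hn0 : (0 : ℝ) < n := by exact_mod_cast hn
  have hψm : 0 < ψ m := lt_of_lt_of_le (by positivity) m0
  set A := (Finset.Icc 1 m).filter (fun a => Nat.gcd a m = 1) with hA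
  set X : ℝ := n * (2 * (ψ m / m)) with hX
  have hnX : 2 * √n ≤ X := by
    have h1 : (m : ℝ) ^ 2 ≤ √n := by
      apply Real.le_sqrt_of_sq_le
      have : ((m ^ 4 : ℕ) : ℝ) ≤ n := by exact_mod_cast hmn
      push_cast at this
      nlinarith
    have h2 : 1 / (m : ℝ) ^ 2 ≤ ψ m / m := by
      calc 1 / (m : ℝ) ^ 2 = (1 / m) / m := by field_simp
        _ ≤ _ := by gcongr
    have h3 : √(n : ℝ) * √n = n := Real.mul_self_sqrt hn0.le
    have h4 : √(n : ℝ) ≤ n * (1 / (m : ℝ) ^ 2) := by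
      rw [mul_one_div, le_div_iff₀ (by positivity)]
      nlinarith [Real.sqrt_nonneg (n : ℝ)]
    have h5 : n * (1 / (m : ℝ) ^ 2) ≤ n * (ψ m / m) := by gcongr
    rw [hX]; linarith
  set x : ℕ → ℝ := fun a => n * ((a - ψ m) / m) - ψ n with hx
  set y : ℕ → ℝ := fun a => n * ((a + ψ m) / m) + ψ n with hy
  have hyx : ∀ a, y a - x a = X + 2 * ψ n := by
    intro a; simp only [hx, hy, hX]; field_simp; ring
  set B : ℕ → Finset ℤ := fun a => (Finset.Ioc ⌊x a⌋ ⌊y a⌋).filter (fun k : ℤ => IsCoprime k (n : ℤ)) with hB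
  have hBc : ∀ a, ((B a).card : ℝ) ≤ 3000 * X * (n.totient / n) := by
    intro a
    have h1 := hyx a
    have : 0 ≤ √(n : ℝ) := Real.sqrt_nonneg _
    exact count_bound n hn (x a) (y a) X (by linarith) (by linarith) hnX
  set J : ℤ → Set UnitAddCircle := fun b => (fun x : ℝ => (x : UnitAddCircle)) '' Set.Ioo ((b : ℝ) / n - ψ n / n) ((b : ℝ) / n + ψ n / n) with hJ
  have hsub : approxSet ψ m ∩ approxSet ψ n ⊆ ⋃ a ∈ A, ⋃ b ∈ B a, J b := by
    rintro z ⟨hz1, hz2⟩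
    simp only [approxSet, Set.mem_iUnion] at hz1 hz2
    obtain ⟨a, ha, u, hu, rfl⟩ := hz1
    obtain ⟨b, hb, v, hv, huv⟩ := hz2
    obtain ⟨k, hk⟩ : ∃ k : ℤ, v - u = k := by
      have huv' : (v : UnitAddCircle) = u := huv
      rw [← sub_eq_zero, ← AddCircle.coe_sub, AddCircle.coe_eq_zero_iff] at huv'
      obtain ⟨k, hk⟩ := huv'
      exact ⟨k, by simpa using hk.symm⟩
    have hv' : v = u + k := by linarith
    subst hv'
    obtain ⟨hv1, hv2⟩ := hv
    obtain ⟨hu1, hu2⟩ := hu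
    rw [div_lt_iff₀ hn0] at hv1
    rw [lt_div_iff₀ hn0] at hv2
    have hu1' : n * ((a - ψ m) / m) < n * u := by gcongr
    have hu2' : n * u < n * ((a + ψ m) / m) := by gcongr
    simp only [Set.mem_iUnion]
    refine ⟨a, ?_, (b : ℤ) - k * n, ?_, u, ?_, rfl⟩
    · simp only [hA, Finset.mem_filter, Finset.mem_Icc]
      exact ⟨⟨ha.1, ha.2.1⟩, ha.2.2⟩
    · simp only [hB, Finset.mem_filter, Finset.mem_Ioc, Int.floor_lt, Int.le_floor]
      push_cast
      refine ⟨⟨?_, ?_⟩, ?_⟩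
      · simp only [hx]; linarith
      · simp only [hy]; linarith
      · have : IsCoprime (b : ℤ) (n : ℤ) := Nat.isCoprime_iff_coprime.mpr hb.2.2
        have := this.add_mul_right_left (-k)
        rwa [neg_mul, ← sub_eq_add_neg] at this
    · push_cast
      rw [← sub_div, ← add_div]
      constructor
      · rw [div_lt_iff₀ hn0]; linarith
      · rw [lt_div_iff₀ hn0]; linarith
  have hpos : 0 ≤ 2 * (ψ n / n) := by positivity
  have hXpos : 0 ≤ X := by positivity
  have hvol : volume (approxSet ψ m ∩ approxSet ψ n) ≤ ENNReal.ofReal (∑ a ∈ A, ∑ b ∈ B a, 2 * (ψ n / n)) := by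
    rw [ENNReal.ofReal_sum_of_nonneg (fun a _ => Finset.sum_nonneg (fun _ _ => hpos))]
    refine (measure_mono hsub).trans ((measure_biUnion_finset_le _ _).trans ?_)
    refine Finset.sum_le_sum fun a _ => ?_
    rw [ENNReal.ofReal_sum_of_nonneg (fun _ _ => hpos)]
    refine (measure_biUnion_finset_le _ _).trans ?_
    exact Finset.sum_le_sum fun b _ => vol_image _ _
  have h1 := ENNReal.toReal_le_of_le_ofReal (Finset.sum_nonneg (fun a _ => Finset.sum_nonneg (fun _ _ => hpos))) hvol
  refine h1.trans ?_
  calc ∑ a ∈ A, ∑ b ∈ B a, 2 * (ψ n / n) ≤ ∑ a ∈ A, (3000 * X * (n.totient / n) * (2 * (ψ n / n))) := by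
        refine Finset.sum_le_sum fun a _ => ?_
        rw [Finset.sum_const, nsmul_eq_mul]
        exact mul_le_mul_of_nonneg_right (hBc a) hpos
    _ = _ := by rw [Finset.sum_const, totient_card m hm, nsmul_eq_mul]

theorem approxSet_zero (ψ : ℕ → ℝ) (n : ℕ) (h : ψ n = 0) : approxSet ψ n = ∅ := by
  simp [approxSet, h]

/-- For `m`, `n` in non-adjacent blocks `Δ_{3h₁}`, `Δ_{3h₂}` with `h₁ < h₂`, the
sets `E_m` and `E_n` are quasi-independent with an absolute constant. -/
theorem quasi_independence_non_adjacent :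
    ∃ C : ℝ, 0 < C ∧ ∀ ψ : ℕ → ℝ,
      (∀ k, ψ k ≠ 0 → 1 / (k : ℝ) ≤ ψ k ∧ ψ k ≤ 1 / 2) →
      ∀ h₁ h₂ : ℕ, 1 ≤ h₁ → h₁ < h₂ →
        ∀ m ∈ Finset.Icc (2 ^ 2 ^ (3 * h₁) + 1) (2 ^ 2 ^ (3 * h₁ + 1)),
          ∀ n ∈ Finset.Icc (2 ^ 2 ^ (3 * h₂) + 1) (2 ^ 2 ^ (3 * h₂ + 1)),
            (volume (approxSet ψ m ∩ approxSet ψ n)).toReal ≤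
              C * (volume (approxSet ψ m)).toReal *
                (volume (approxSet ψ n)).toReal := by
  refine ⟨3000, by norm_num, ?_⟩
  intro ψ hψ h₁ h₂ hh1 hh m hm n hn
  by_cases hm0 : ψ m = 0
  · simp [approxSet_zero ψ m hm0]
  by_cases hn0 : ψ n = 0
  · simp [approxSet_zero ψ n hn0]
  rw [Finset.mem_Icc] at hm hn
  have hm1 : 1 < m := by
    have : 0 < 2 ^ 2 ^ (3 * h₁) := by positivity
    omega
  have hmn : m ^ 4 ≤ n := by
    calc m ^ 4 ≤ (2 ^ 2 ^ (3 * h₁ + 1)) ^ 4 := Nat.pow_le_pow_left hm.2 4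
      _ = 2 ^ 2 ^ (3 * h₁ + 3) := by rw [← pow_mul]; congr 1; ring
      _ ≤ 2 ^ 2 ^ (3 * h₂) :=
        Nat.pow_le_pow_right (by norm_num) (Nat.pow_le_pow_right (by norm_num) (by omega))
      _ ≤ n := by omega
  have hn1 : 1 < n := by
    have : 0 < 2 ^ 2 ^ (3 * h₂) := by positivity
    omega
  obtain ⟨a1, a2⟩ := hψ m hm0
  obtain ⟨b1, b2⟩ := hψ n hn0
  have hmr : (0 : ℝ) < m := by exact_mod_cast (by omega : 0 < m)
  have hnr : (0 : ℝ) < n := by exact_mod_cast (by omega : 0 < n)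
  have a0 : 0 < ψ m := lt_of_lt_of_le (by positivity) a1
  have b0 : 0 < ψ n := lt_of_lt_of_le (by positivity) b1
  have L1 := vol_lower ψ m hm1 a0 a2
  have L2 := vol_lower ψ n hn1 b0 b2
  refine (vol_upper ψ m n hm1 hmn a1 b0 b2).trans ?_
  have := mul_le_mul L1 L2 (by positivity) ENNReal.toReal_nonneg
  calc _ = 3000 * ((m.totient * (2 * (ψ m / m))) * (n.totient * (2 * (ψ n / n)))) := by
        field_simp
    _ ≤ 3000 * ((volume (approxSet ψ m)).toReal * (volume (approxSet ψ n)).toReal) := by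
        gcongr
    _ = _ := by ring
end
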